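/- Let (X, ⟨·,·⟩) be a real inner product space, D ⊆ X a nonempty convex set, n ≥ 1, and ω₁,…,ωₙ : D → ℝ positive-valued. Define Eᵢ : D × D → X* by Eᵢ(u,v)(h) := 2ωᵢ(u)⟨u − v, h⟩. Then each Eᵢ is a generalized deviation function, and for every x ∈ Dⁿ the generalized deviation mean equals the functionally weighted arithmetic mean: the point y = (ω₁(x₁)x₁ + ⋯ + ωₙ(xₙ)xₙ)/(ω₁(x₁) + ⋯ + ωₙ(xₙ)) is the unique element of conv{x₁,…,xₙ} satisfying (E₁(x₁,y) + ⋯ + Eₙ(xₙ,y))(xᵢ − y) ≤ 0 for all i ∈ {1,…,n}. -/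

import Mathlib

/-- The weighted sum of the functionals `⟪x j - y, ·⟫` is represented by the total weight times
the displacement from `y` to the center of mass. -/
theorem sum_two_mul_smul_innerSL_sub {X ι : Type*} [NormedAddCommGroup X] [InnerProductSpace ℝ X]
    [Fintype ι] (w : ι → ℝ) (x : ι → X) (hw : ∑ j, w j ≠ 0) (y : X) :
    ∑ j, (2 * w j) • innerSL ℝ (x j - y) =
      (2 * ∑ j, w j) • innerSL ℝ (Finset.univ.centerMass w x - y) := by
  have hvec : ∑ j, w j • (x j - y) = (∑ j, w j) • (Finset.univ.centerMass w x - y) := by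
    simp_rw [smul_sub, Finset.sum_sub_distrib, ← Finset.sum_smul, Finset.centerMass,
      smul_inv_smul₀ hw]
  ext p
  simp only [sum_apply, smul_apply, innerSL_apply_apply, smul_eq_mul, mul_assoc,
    ← real_inner_smul_left, ← sum_inner, ← Finset.smul_sum, hvec]

/-- If `z` lies in the convex hull of the points `x i`, and `z - y` makes no acute angle with any
`x i - y`, then `z = y`. -/
theorem eq_of_forall_inner_sub_nonpos {X ι : Type*} [NormedAddCommGroup X]
    [InnerProductSpace ℝ X] {x : ι → X} {y z : X} (hz : z ∈ convexHull ℝ (Set.range x))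
    (h : ∀ i, inner ℝ (z - y) (x i - y) ≤ 0) : z = y := by
  have hsub : convexHull ℝ (Set.range x) ⊆ {p | innerSL ℝ (z - y) p ≤ innerSL ℝ (z - y) y} := by
    refine convexHull_min ?_ (convex_halfSpace_le (innerSL ℝ (z - y)).isLinear _)
    rintro _ ⟨i, rfl⟩
    have hi := h i
    rwa [inner_sub_right, sub_nonpos] at hi
  have hzy : inner ℝ (z - y) (z - y) ≤ 0 := by
    rw [inner_sub_right]
    exact sub_nonpos.2 (hsub hz)
  exact sub_eq_zero.1 (real_inner_self_nonpos.1 hzy)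


/-- In an inner product space, `Eᵢ(u,v)(h) := 2ωᵢ(u)⟨u − v, h⟩` are
generalized deviations and the generalized deviation mean they generate is the
functionally weighted arithmetic mean. -/
theorem inner_product_deviation_mean_is_weighted_arithmetic
    {X : Type*} [NormedAddCommGroup X] [InnerProductSpace ℝ X]
    (D : Set X) (hD : D.Nonempty) (hDconv : Convex ℝ D)
    (n : ℕ) (hn : 0 < n)
    (ω : Fin n → X → ℝ) (hω : ∀ i, ∀ u ∈ D, 0 < ω i u) :
    letI E : Fin n → X → X → X →L[ℝ] ℝ := fun i u v => (2 * ω i u) • innerSL ℝ (u - v)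
    (∀ i,
      (∀ u ∈ D, E i u u = 0) ∧
      (∀ u ∈ D, ∀ h : X, ContinuousOn (fun v => E i u v h) D) ∧
      (∀ u ∈ D, ∀ v ∈ D, ∀ w ∈ D, v ≠ w → (E i u v - E i u w) (v - w) < 0)) ∧
    ∀ x : Fin n → X, (∀ i, x i ∈ D) →
      letI y₀ : X := (∑ i, ω i (x i))⁻¹ • ∑ i, ω i (x i) • x i
      y₀ ∈ convexHull ℝ (Set.range x) ∧
      (∀ i, (∑ j, E j (x j) y₀) (x i - y₀) ≤ 0) ∧
      ∀ y ∈ convexHull ℝ (Set.range x),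
        (∀ i, (∑ j, E j (x j) y) (x i - y) ≤ 0) → y = y₀ := by
  have hdev : ∀ (i : Fin n) (u v w : X),
      ((2 * ω i u) • innerSL ℝ (u - v) - (2 * ω i u) • innerSL ℝ (u - w)) (v - w) =
        -(2 * ω i u * ‖v - w‖ ^ 2) := by
    intro i u v w
    rw [← smul_sub, ← map_sub, sub_sub_sub_cancel_left, ← neg_sub v w, map_neg,
      smul_neg, neg_apply, smul_apply, innerSL_apply_apply, real_inner_self_eq_norm_sq,
      smul_eq_mul]
  refine ⟨fun i => ⟨fun u _ => by simp, fun u _ h => ?_, fun u hu v _ w _ hvw => ?_⟩,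
    fun x hx => ?_⟩
  · simp only [smul_apply, innerSL_apply_apply]
    fun_prop
  · rw [hdev]
    have hω' := hω i u hu
    have hnorm : 0 < ‖v - w‖ := norm_pos_iff.2 (sub_ne_zero.2 hvw)
    exact neg_neg_of_pos (by positivity)
  · have hpos : ∀ i, 0 < ω i (x i) := fun i => hω i _ (hx i)
    have hsum : 0 < ∑ i, ω i (x i) :=
      Finset.sum_pos (fun i _ => hpos i) ⟨⟨0, hn⟩, Finset.mem_univ _⟩
    have hmem : Finset.univ.centerMass (fun i => ω i (x i)) x ∈ convexHull ℝ (Set.range x) :=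
      Finset.centerMass_mem_convexHull _ (fun i _ => (hpos i).le) hsum
        fun i _ => Set.mem_range_self i
    refine ⟨hmem, fun i => ?_, fun y _ hyx => ?_⟩
    · rw [sum_two_mul_smul_innerSL_sub _ x hsum.ne', Finset.centerMass, sub_self]
      simp
    · simp only [sum_two_mul_smul_innerSL_sub _ x hsum.ne'] at hyx
      exact (eq_of_forall_inner_sub_nonpos hmem fun i =>
        nonpos_of_mul_nonpos_right (hyx i) (mul_pos two_pos hsum)).symm
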